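/- Let n ≥ 1, let l_1,…,l_n > 0 and m_1,…,m_n ≥ 0 be real numbers, and let φ : ℝ^n → ℝ be a smooth compactly supported function. Then the holomorphic function H(φ)(λ) = ∫_{ℝ^n} |x_1|^{l_1λ+m_1} ⋯ |x_n|^{l_nλ+m_n} φ(x) dx, defined for Re λ > -min_i (m_i+1)/l_i, extends to a meromorphic function on all of ℂ whose poles are contained in P = ∪_{i=1}^n { -(m_i+r)/l_i : r ∈ ℤ, r ≥ 1 }, and for each element -λ_j of P the order of the pole of this extension at λ = -λ_j is at most k_j = #S_j, where S_j = { 1 ≤ i ≤ n : there exists r ∈ ℤ_{>0} with (m_i+r)/l_i = λ_j }. -/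

import Mathlib

open MeasureTheory Filter Set
open scoped Topology

/-- `|x|^s`: equals `exp(s log |x|)` for `x ≠ 0` and `0` for `x = 0`. -/
noncomputable def absPow (x : ℝ) (s : ℂ) : ℂ := if x = 0 then 0 else ((|x| : ℝ) : ℂ) ^ s

/-- `H(φ)(λ) = ∫_{ℝⁿ} |x₁|^(l₁λ+m₁) ⋯ |x_n|^(l_nλ+m_n) φ(x) dx`. -/
noncomputable def Hint (n : ℕ) (l m : Fin n → ℝ) (φ : (Fin n → ℝ) → ℝ) (lam : ℂ) : ℂ :=
  ∫ x : Fin n → ℝ, (∏ i, absPow (x i) ((l i : ℂ) * lam + (m i : ℂ))) * (φ x : ℂ)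

/-- The set of candidate poles `P = ∪_i {-(m_i+r)/l_i : r ∈ ℤ, r ≥ 1} ⊆ ℝ`. -/
def polesP (n : ℕ) (l m : Fin n → ℝ) : Set ℝ :=
  {t | ∃ i : Fin n, ∃ r : ℕ, 0 < r ∧ t = -((m i + (r : ℝ)) / l i)}

/-- `k_j = #S_j` where `S_j = {i : ∃ r ∈ ℤ_{>0}, (m_i+r)/l_i = μ}`. -/
noncomputable def kOrd (n : ℕ) (l m : Fin n → ℝ) (μ : ℝ) : ℕ :=
  Set.ncard {i : Fin n | ∃ r : ℕ, 0 < r ∧ (m i + (r : ℝ)) / l i = μ}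

/-- An integral depending on a complex parameter is complex differentiable when the integrand is
holomorphic and locally uniformly dominated by an integrable function. -/
theorem differentiableAt_integral_of_dominated {α : Type*} [MeasurableSpace α] {μ : Measure α}
    {f : ℂ → α → ℂ} {z₀ : ℂ} {ε : ℝ} (hε : 0 < ε) {bound : α → ℝ}
    (hmeas : ∀ z, AEStronglyMeasurable (f z) μ) (hdiff : ∀ a, Differentiable ℂ (f · a))
    (hbound : ∀ a, ∀ z ∈ Metric.ball z₀ ε, ‖f z a‖ ≤ bound a) (hinteg : Integrable bound μ) :
    DifferentiableAt ℂ (fun z => ∫ a, f z a ∂μ) z₀ := by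
  have hderiv_meas : AEStronglyMeasurable (fun a => deriv (f · a) z₀) μ := by
    have hseq : Tendsto (fun k : ℕ => (1 : ℂ) / ((k : ℂ) + 1)) atTop (𝓝[≠] 0) := by
      refine tendsto_nhdsWithin_iff.2 ⟨tendsto_one_div_add_atTop_nhds_zero_nat, ?_⟩
      exact Eventually.of_forall fun k => one_div_ne_zero (Nat.cast_add_one_ne_zero k)
    refine aestronglyMeasurable_of_tendsto_ae atTop
      (f := fun (k : ℕ) a => ((1 : ℂ) / ((k : ℂ) + 1))⁻¹ •
        (f (z₀ + (1 : ℂ) / ((k : ℂ) + 1)) a - f z₀ a)) ?_ ?_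
    · exact fun k => ((hmeas (z₀ + (1 : ℂ) / ((k : ℂ) + 1))).sub (hmeas z₀)).const_smul
        ((1 : ℂ) / ((k : ℂ) + 1))⁻¹
    · exact Eventually.of_forall fun a =>
        ((hdiff a).differentiableAt.hasDerivAt.tendsto_slope_zero).comp hseq
  have hz₀ : z₀ ∈ Metric.ball z₀ ε := Metric.mem_ball_self hε
  refine (hasDerivAt_integral_of_dominated_loc_of_deriv_le (F := f)
    (F' := fun z a => deriv (f · a) z) (bound := fun a => bound a / (ε / 2))
    (Metric.ball_mem_nhds z₀ (half_pos hε)) (Eventually.of_forall hmeas)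
    (hinteg.mono' (hmeas _) (Eventually.of_forall fun a => hbound a z₀ hz₀)) hderiv_meas
    (Eventually.of_forall fun a z hz => ?_) (hinteg.div_const _)
    (Eventually.of_forall fun a z _ =>
      (hdiff a).differentiableAt.hasDerivAt)).2.differentiableAt
  refine Complex.norm_deriv_le_of_forall_mem_sphere_norm_le (half_pos hε)
    (hdiff a).diffContOnCl fun w hw => hbound a w ?_
  rw [Metric.mem_ball] at hz ⊢
  rw [Metric.mem_sphere] at hw
  linarith [dist_triangle w z z₀]

theorem norm_absPow_le (x : ℝ) {a b : ℝ} {s : ℂ} (ha : a ≤ s.re) (hb : s.re ≤ b) :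
    ‖absPow x s‖ ≤ |x| ^ a + |x| ^ b := by
  have hx := abs_nonneg x
  rw [absPow]
  split_ifs with h
  · rw [norm_zero]; positivity
  · have hpos := abs_pos.2 h
    rw [Complex.norm_cpow_eq_rpow_re_of_pos hpos]
    rcases le_total |x| 1 with h1 | h1
    · exact (Real.rpow_le_rpow_of_exponent_ge hpos h1 ha).trans
        (le_add_of_nonneg_right (by positivity))
    · exact (Real.rpow_le_rpow_of_exponent_le h1 hb).trans
        (le_add_of_nonneg_left (by positivity))

theorem differentiable_absPow (x : ℝ) : Differentiable ℂ (absPow x) := by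
  unfold absPow
  split_ifs with h
  · exact differentiable_const _
  · intro s
    exact differentiableAt_id.const_cpow (Or.inl (by simpa using h))

theorem measurable_absPow (s : ℂ) : Measurable (absPow · s) := by
  unfold absPow
  exact Measurable.ite (measurableSet_eq) measurable_const
    ((Complex.measurable_ofReal.comp continuous_abs.measurable).pow_const s)

theorem absPow_neg (x : ℝ) (s : ℂ) : absPow (-x) s = absPow x s := by
  simp [absPow]

theorem absPow_of_pos {x : ℝ} (hx : 0 < x) (s : ℂ) : absPow x s = (x : ℂ) ^ s := by
  rw [absPow, if_neg hx.ne', abs_of_pos hx]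

theorem integrable_indicator_abs_rpow {a : ℝ} (ha : -1 < a) (R : ℝ) :
    Integrable ((Icc (-R) R).indicator fun x : ℝ => |x| ^ a) := by
  rw [integrable_indicator_iff measurableSet_Icc]
  rcases lt_or_ge R 0 with hR | hR
  · rw [Icc_eq_empty (by linarith)]; exact integrableOn_empty
  have hpos : IntegrableOn (fun x : ℝ => |x| ^ a) (Icc 0 R) := by
    rw [integrableOn_Icc_iff_integrableOn_Ioc]
    refine ((intervalIntegrable_iff_integrableOn_Ioc_of_le hR).1
      (intervalIntegral.intervalIntegrable_rpow' ha)).congr_fun (fun x hx => ?_) measurableSet_Ioc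
    simp only [abs_of_pos hx.1]
  have hneg : IntegrableOn (fun x : ℝ => |x| ^ a) (Icc (-R) 0) := by
    have := hpos.comp_neg
    simpa using this
  rw [← Icc_union_Icc_eq_Icc (neg_nonpos.2 hR) hR]
  exact hneg.union hpos

/-- The integral of `∏ |x_i| ^ s_i` against `φ`, with independent complex exponents. -/
noncomputable def monomialIntegral {n : ℕ} (φ : (Fin n → ℝ) → ℝ) (s : Fin n → ℂ) : ℂ :=
  ∫ x : Fin n → ℝ, (∏ i, absPow (x i) (s i)) * (φ x : ℂ)

theorem exists_integrable_bound {n : ℕ} {φ : (Fin n → ℝ) → ℝ} (hφ : Continuous φ)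
    (hφc : HasCompactSupport φ) {a b : Fin n → ℝ} (ha : ∀ i, -1 < a i) (hb : ∀ i, -1 < b i) :
    ∃ bound : (Fin n → ℝ) → ℝ, Integrable bound ∧ ∀ x, ∀ s : Fin n → ℂ,
      (∀ i, a i ≤ (s i).re ∧ (s i).re ≤ b i) →
      ‖(∏ i, absPow (x i) (s i)) * (φ x : ℂ)‖ ≤ bound x := by
  obtain ⟨C, hC⟩ := hφ.bounded_above_of_compact_support hφc
  obtain ⟨R, hR⟩ := hφc.isCompact.isBounded.subset_closedBall 0
  let g : Fin n → ℝ → ℝ := fun i t => (Icc (-R) R).indicator (fun t : ℝ => |t| ^ a i) t +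
    (Icc (-R) R).indicator (fun t : ℝ => |t| ^ b i) t
  have hg : ∀ i, Integrable (g i) := fun i =>
    (integrable_indicator_abs_rpow (ha i) R).add (integrable_indicator_abs_rpow (hb i) R)
  refine ⟨fun x => (∏ i, g i (x i)) * C, (Integrable.fintype_prod hg).mul_const C, ?_⟩
  intro x s hs
  have hC0 : 0 ≤ C := (norm_nonneg _).trans (hC x)
  by_cases hx : φ x = 0
  · rw [hx, Complex.ofReal_zero, mul_zero, norm_zero]
    refine mul_nonneg (Finset.prod_nonneg fun i _ => add_nonneg ?_ ?_) hC0 <;>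
      exact indicator_nonneg (fun t _ => by positivity) _
  · have hxR := hR (subset_tsupport φ hx)
    rw [mem_closedBall_zero_iff] at hxR
    rw [norm_mul, norm_prod, Complex.norm_real]
    refine mul_le_mul (Finset.prod_le_prod (fun i _ => norm_nonneg _) fun i _ => ?_) (hC x)
      (norm_nonneg _) (Finset.prod_nonneg fun i _ => add_nonneg ?_ ?_)
    · have hi : x i ∈ Icc (-R) R := abs_le.1 ((norm_le_pi_norm x i).trans hxR)
      simp only [g, indicator_of_mem hi]
      exact norm_absPow_le _ (hs i).1 (hs i).2
    all_goals exact indicator_nonneg (fun t _ => by positivity) _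

theorem measurable_monomial_mul {n : ℕ} {φ : (Fin n → ℝ) → ℝ} (hφ : Continuous φ)
    (s : Fin n → ℂ) : Measurable fun x : Fin n → ℝ => (∏ i, absPow (x i) (s i)) * (φ x : ℂ) :=
  (Finset.measurable_fun_prod _ fun i _ =>
    (measurable_absPow (s i)).comp (measurable_pi_apply i)).mul
    (Complex.measurable_ofReal.comp hφ.measurable)

theorem integrable_monomial_mul {n : ℕ} {φ : (Fin n → ℝ) → ℝ} (hφ : Continuous φ)
    (hφc : HasCompactSupport φ) {s : Fin n → ℂ} (hs : ∀ i, -1 < (s i).re) :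
    Integrable fun x : Fin n → ℝ => (∏ i, absPow (x i) (s i)) * (φ x : ℂ) := by
  obtain ⟨bound, hinteg, hbound⟩ := exists_integrable_bound hφ hφc hs hs
  exact hinteg.mono' (measurable_monomial_mul hφ s).aestronglyMeasurable
    (Eventually.of_forall fun x => hbound x s fun i => ⟨le_rfl, le_rfl⟩)

theorem analyticAt_monomialIntegral {n : ℕ} {φ : (Fin n → ℝ) → ℝ} (hφ : Continuous φ)
    (hφc : HasCompactSupport φ) {s : ℂ → Fin n → ℂ} (hdiff : Differentiable ℂ s) {z₀ : ℂ}
    (hs : ∀ i, -1 < (s z₀ i).re) :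
    AnalyticAt ℂ (fun z => monomialIntegral φ (s z)) z₀ := by
  have hcont : ∀ i, Continuous fun z => (s z i).re := fun i =>
    Complex.continuous_re.comp ((continuous_apply i).comp hdiff.continuous)
  refine Complex.analyticAt_iff_eventually_differentiableAt.2 ?_
  have hev : ∀ᶠ z in 𝓝 z₀, ∀ i, -1 < (s z i).re :=
    eventually_all.2 fun i => (hcont i).continuousAt.eventually (lt_mem_nhds (hs i))
  filter_upwards [hev] with z hz
  choose a ha using fun i => exists_between (hz i)
  have hnear : ∀ᶠ w in 𝓝 z, ∀ i, a i < (s w i).re ∧ (s w i).re < (s z i).re + 1 :=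
    eventually_all.2 fun i => (hcont i).continuousAt.eventually
      ((lt_mem_nhds (ha i).2).and (gt_mem_nhds (lt_add_one _)))
  obtain ⟨ε, hε, hball⟩ := Metric.eventually_nhds_iff_ball.1 hnear
  obtain ⟨bound, hinteg, hbound⟩ := exists_integrable_bound hφ hφc (fun i => (ha i).1)
    (b := fun i => (s z i).re + 1) fun i => (hz i).trans (lt_add_one _)
  refine differentiableAt_integral_of_dominated hε
    (fun w => (measurable_monomial_mul hφ (s w)).aestronglyMeasurable) (fun x => ?_)
    (fun x w hw => hbound x (s w) fun i => ⟨(hball w hw i).1.le, (hball w hw i).2.le⟩) hinteg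
  refine (Differentiable.fun_finsetProd fun i _ => ?_).mul (differentiable_const _)
  exact (differentiable_absPow (x i)).comp (differentiable_pi.1 hdiff i)

theorem continuous_ofReal_cpow_const_mul {s : ℂ} (hs : 0 < s.re) {g : ℝ → ℝ} (hg : Continuous g) :
    Continuous fun t : ℝ => (t : ℂ) ^ s * (g t : ℂ) :=
  (Complex.continuous_ofReal_cpow_const hs).mul (Complex.continuous_ofReal.comp hg)

/-- Two integrations by parts on the positive half-line against a power. -/
theorem integral_Ioi_cpow_mul_sub {g g' g'' : ℝ → ℝ} (hg : ∀ t, HasDerivAt g (g' t) t)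
    (hg' : ∀ t, HasDerivAt g' (g'' t) t) {R : ℝ} (hR : ∀ t, R < t → g t = 0) {s : ℂ}
    (hs : -1 < s.re)
    (hinteg : IntegrableOn (fun t : ℝ => absPow t s * (g t : ℂ) -
      ((s + 1) * (s + 2))⁻¹ * (absPow t (s + 2) * (g'' t : ℂ))) (Ioi 0)) :
    ∫ t in Ioi (0 : ℝ), (absPow t s * (g t : ℂ) -
      ((s + 1) * (s + 2))⁻¹ * (absPow t (s + 2) * (g'' t : ℂ))) = 0 := by
  have h1 : 0 < (s + 1).re := by simp; linarith
  have h2 : 0 < (s + 2).re := by simp; linarith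
  have h1' : s + 1 ≠ 0 := fun h => by simp [h] at h1
  have h2' : s + 2 ≠ 0 := fun h => by simp [h] at h2
  have hR' : ∀ t, R < t → g' t = 0 := fun t ht => by
    have hev : g =ᶠ[𝓝 t] fun _ => 0 := by
      filter_upwards [lt_mem_nhds ht] with u hu using hR u hu
    exact (hg t).unique ((hasDerivAt_const t (0 : ℝ)).congr_of_eventuallyEq hev)
  have hgc : Continuous g := continuous_iff_continuousAt.2 fun t => (hg t).continuousAt
  have hgc' : Continuous g' := continuous_iff_continuousAt.2 fun t => (hg' t).continuousAt
  let u : ℝ → ℂ := fun t => (s + 1)⁻¹ * ((t : ℂ) ^ (s + 1) * (g t : ℂ)) -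
    ((s + 1) * (s + 2))⁻¹ * ((t : ℂ) ^ (s + 2) * (g' t : ℂ))
  have hu : Continuous u :=
    (continuous_const.mul (continuous_ofReal_cpow_const_mul h1 hgc)).sub
      (continuous_const.mul (continuous_ofReal_cpow_const_mul h2 hgc'))
  have hlim : Tendsto u atTop (𝓝 0) := by
    refine tendsto_const_nhds.congr' ?_
    filter_upwards [eventually_gt_atTop R] with t ht
    simp [u, hR t ht, hR' t ht]
  rw [integral_Ioi_of_hasDerivAt_of_tendsto (f := u) (m := 0) hu.continuousWithinAt ?_ hinteg hlim]
  · simp [u, Complex.zero_cpow h1', Complex.zero_cpow h2']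
  · intro t ht
    rw [absPow_of_pos ht, absPow_of_pos ht]
    have hd1 := ((hasDerivAt_ofReal_cpow_const (ne_of_gt ht) h1').mul
      (hg t).ofReal_comp).const_mul (s + 1)⁻¹
    have hd2 := ((hasDerivAt_ofReal_cpow_const (ne_of_gt ht) h2').mul
      (hg' t).ofReal_comp).const_mul ((s + 1) * (s + 2))⁻¹
    refine (hd1.sub hd2).congr_deriv ?_
    rw [show s + 1 - 1 = s by ring, show s + 2 - 1 = s + 1 by ring]
    field_simp
    ring

/-- Two integrations by parts on the line against a power of the absolute value. -/
theorem integral_absPow_mul_sub {g g' g'' : ℝ → ℝ} (hg : ∀ t, HasDerivAt g (g' t) t)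
    (hg' : ∀ t, HasDerivAt g' (g'' t) t) {R : ℝ} (hR : ∀ t, R < |t| → g t = 0) {s : ℂ}
    (hs : -1 < s.re)
    (hinteg : Integrable fun t : ℝ => absPow t s * (g t : ℂ) -
      ((s + 1) * (s + 2))⁻¹ * (absPow t (s + 2) * (g'' t : ℂ))) :
    ∫ t : ℝ, (absPow t s * (g t : ℂ) -
      ((s + 1) * (s + 2))⁻¹ * (absPow t (s + 2) * (g'' t : ℂ))) = 0 := by
  rw [← intervalIntegral.integral_Iic_add_Ioi (b := 0) hinteg.integrableOn hinteg.integrableOn,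
    integral_Ioi_cpow_mul_sub hg hg' (fun t ht => hR t (ht.trans_le (le_abs_self t))) hs
      hinteg.integrableOn, add_zero, ← neg_zero, ← integral_comp_neg_Ioi]
  have hgn : ∀ t, HasDerivAt (fun t => g (-t)) (-g' (-t)) t := fun t =>
    ((hg (-t)).comp t (hasDerivAt_neg t)).congr_deriv (by ring)
  have hgn' : ∀ t, HasDerivAt (fun t => -g' (-t)) (g'' (-t)) t := fun t =>
    (((hg' (-t)).comp t (hasDerivAt_neg t)).neg).congr_deriv (by ring)
  have := integral_Ioi_cpow_mul_sub hgn hgn' (R := R) (fun t ht => hR (-t) (by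
    rw [abs_neg]; exact ht.trans_le (le_abs_self t))) hs
    (by simpa only [absPow_neg] using hinteg.comp_neg.integrableOn)
  simpa only [absPow_neg] using this

theorem integrable_absPow_mul {g : ℝ → ℝ} (hg : Continuous g) {R : ℝ}
    (hR : ∀ t, R < |t| → g t = 0) {s : ℂ} (hs : -1 < s.re) :
    Integrable fun t : ℝ => absPow t s * (g t : ℂ) := by
  have hdom := (integrable_indicator_abs_rpow hs R).add (integrable_indicator_abs_rpow hs R)
  obtain ⟨C, hC⟩ := isCompact_Icc.exists_bound_of_continuousOn (s := Icc (-R) R) hg.continuousOn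
  refine (hdom.mul_const C).mono' ((measurable_absPow s).mul
    (Complex.measurable_ofReal.comp hg.measurable)).aestronglyMeasurable
    (Eventually.of_forall fun t => ?_)
  rw [norm_mul, Complex.norm_real]
  by_cases ht : t ∈ Icc (-R) R
  · simp only [Pi.add_apply, indicator_of_mem ht]
    exact mul_le_mul (norm_absPow_le t le_rfl le_rfl) (hC t ht) (norm_nonneg _) (by positivity)
  · simp [indicator_of_notMem ht, hR t (not_le.1 fun h => ht (abs_le.1 h))]

theorem hasDerivAt_comp_insertNth {k : ℕ} {ψ : (Fin (k + 1) → ℝ) → ℝ} (hψ : Differentiable ℝ ψ)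
    (j : Fin (k + 1)) (y : Fin k → ℝ) (t : ℝ) :
    HasDerivAt (fun t => ψ (j.insertNth (α := fun _ => ℝ) t y))
      (fderiv ℝ ψ (j.insertNth (α := fun _ => ℝ) t y) (Pi.single j 1)) t := by
  refine (hψ _).hasFDerivAt.comp_hasDerivAt t (hasDerivAt_pi.2 fun i => ?_)
  induction i using j.succAboveCases with
  | x => simpa using hasDerivAt_id' t
  | p i => simpa using hasDerivAt_const t (y i)

/-- Two integrations by parts in one of the variables of a monomial integral. -/
theorem monomialIntegral_eq_of_coord {k : ℕ} {φ φ' φ'' : (Fin (k + 1) → ℝ) → ℝ}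
    (hφ : Continuous φ) (hφc : HasCompactSupport φ)
    (hφ'' : Continuous φ'') (hφ''c : HasCompactSupport φ'') {j : Fin (k + 1)}
    (hd : ∀ y t, HasDerivAt (fun t => φ (j.insertNth (α := fun _ => ℝ) t y))
      (φ' (j.insertNth (α := fun _ => ℝ) t y)) t)
    (hd' : ∀ y t, HasDerivAt (fun t => φ' (j.insertNth (α := fun _ => ℝ) t y))
      (φ'' (j.insertNth (α := fun _ => ℝ) t y)) t)
    {s : Fin (k + 1) → ℂ} (hs : ∀ i, -1 < (s i).re) :
    monomialIntegral φ s = ((s j + 1) * (s j + 2))⁻¹ *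
      monomialIntegral φ'' (Function.update s j (s j + 2)) := by
  have hs' : ∀ i, -1 < (Function.update s j (s j + 2) i).re := fun i => by
    by_cases hi : i = j
    · subst hi
      have := hs i
      simp; linarith
    · simpa [hi] using hs i
  have hinteg := integrable_monomial_mul hφ hφc hs
  have hinteg'' := (integrable_monomial_mul hφ'' hφ''c hs').const_mul ((s j + 1) * (s j + 2))⁻¹
  unfold monomialIntegral
  rw [← sub_eq_zero, ← integral_const_mul, ← integral_sub hinteg hinteg'',
    ← ((volume_preserving_piFinSuccAbove (fun _ => ℝ) j).symm).integral_comp',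
    Measure.volume_eq_prod, integral_prod_symm]
  · refine integral_eq_zero_of_ae (Eventually.of_forall fun y => ?_)
    have hins : Continuous fun t : ℝ => j.insertNth (α := fun _ => ℝ) t y :=
      continuous_pi fun i => by
        induction i using j.succAboveCases with
        | x => simpa using continuous_id'
        | p i => simpa using continuous_const
    obtain ⟨R, hR⟩ := hφc.isCompact.isBounded.subset_closedBall 0
    obtain ⟨R'', hR''⟩ := hφ''c.isCompact.isBounded.subset_closedBall 0
    have hsupp : ∀ {ψ : (Fin (k + 1) → ℝ) → ℝ} {r : ℝ},
        tsupport ψ ⊆ Metric.closedBall 0 r → ∀ t, r < |t| →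
        ψ (j.insertNth (α := fun _ => ℝ) t y) = 0 := fun {ψ r} hr t ht => by
      by_contra hne
      have hmem := hr (subset_tsupport ψ hne)
      rw [mem_closedBall_zero_iff] at hmem
      have := (norm_le_pi_norm (j.insertNth (α := fun _ => ℝ) t y) j).trans hmem
      rw [Fin.insertNth_apply_same, Real.norm_eq_abs] at this
      linarith
    have hzero := integral_absPow_mul_sub (hd y) (hd' y) (hsupp hR) (hs j)
      ((integrable_absPow_mul (hφ.comp hins) (hsupp hR) (hs j)).sub
        ((integrable_absPow_mul (hφ''.comp hins) (hsupp hR'') (s := s j + 2)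
          (by simpa using hs' j)).const_mul _))
    have hfactor := congrArg ((∏ i, absPow (y i) (s (j.succAbove i))) * ·) hzero
    simp only [mul_zero] at hfactor
    rw [Pi.zero_apply, ← hfactor, ← integral_const_mul]
    refine integral_congr_ae (Eventually.of_forall fun t => ?_)
    have hsymm : (MeasurableEquiv.piFinSuccAbove (fun _ => ℝ) j).symm (t, y) =
        j.insertNth (α := fun _ => ℝ) t y := rfl
    simp only [hsymm, Fin.prod_univ_succAbove _ j, Fin.insertNth_apply_same,
      Fin.insertNth_apply_succAbove, Function.update_self, ne_eq, Fin.succAbove_ne,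
      not_false_eq_true, Function.update_of_ne]
    ring
  · exact ((volume_preserving_piFinSuccAbove (fun _ => ℝ) j).symm).integrable_comp_of_integrable
      (hinteg.sub hinteg'')

theorem exists_monomialIntegral_eq_coord {n : ℕ} {φ : (Fin n → ℝ) → ℝ}
    (hφ : ContDiff ℝ (⊤ : ℕ∞) φ) (hφc : HasCompactSupport φ) (j : Fin n) :
    ∃ ψ : (Fin n → ℝ) → ℝ, ContDiff ℝ (⊤ : ℕ∞) ψ ∧ HasCompactSupport ψ ∧
      ∀ s : Fin n → ℂ, (∀ i, -1 < (s i).re) → monomialIntegral φ s =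
        ((s j + 1) * (s j + 2))⁻¹ * monomialIntegral ψ (Function.update s j (s j + 2)) := by
  obtain ⟨k, rfl⟩ : ∃ k, n = k + 1 := ⟨n - 1, by have := j.pos; omega⟩
  have hsmooth : ∀ {ψ : (Fin (k + 1) → ℝ) → ℝ}, ContDiff ℝ (⊤ : ℕ∞) ψ →
      ContDiff ℝ (⊤ : ℕ∞) fun x => fderiv ℝ ψ x (Pi.single j 1) := fun hψ =>
    (hψ.fderiv_right (m := (⊤ : ℕ∞)) (by simp)).clm_apply contDiff_const
  have hφ' := hsmooth hφ
  have hφ'' := hsmooth hφ'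
  have hφ''c := (hφc.fderiv_apply (𝕜 := ℝ) (Pi.single j 1)).fderiv_apply (𝕜 := ℝ) (Pi.single j 1)
  refine ⟨_, hφ'', hφ''c, fun s hs => ?_⟩
  exact monomialIntegral_eq_of_coord
    (φ' := fun x => fderiv ℝ φ x (Pi.single j 1)) hφ.continuous hφc hφ''.continuous hφ''c
    (fun y t => hasDerivAt_comp_insertNth (hφ.differentiable (by simp)) j y t)
    (fun y t => hasDerivAt_comp_insertNth (hφ'.differentiable (by simp)) j y t) hs

/-- Two integrations by parts in each variable of a monomial integral. -/
theorem exists_monomialIntegral_eq {n : ℕ} {φ : (Fin n → ℝ) → ℝ}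
    (hφ : ContDiff ℝ (⊤ : ℕ∞) φ) (hφc : HasCompactSupport φ) :
    ∃ ψ : (Fin n → ℝ) → ℝ, ContDiff ℝ (⊤ : ℕ∞) ψ ∧ HasCompactSupport ψ ∧
      ∀ s : Fin n → ℂ, (∀ i, -1 < (s i).re) → monomialIntegral φ s =
        (∏ i, ((s i + 1) * (s i + 2))⁻¹) * monomialIntegral ψ fun i => s i + 2 := by
  suffices h : ∀ T : Finset (Fin n), ∃ ψ : (Fin n → ℝ) → ℝ, ContDiff ℝ (⊤ : ℕ∞) ψ ∧
      HasCompactSupport ψ ∧ ∀ s : Fin n → ℂ, (∀ i, -1 < (s i).re) → monomialIntegral φ s =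
        (∏ i ∈ T, ((s i + 1) * (s i + 2))⁻¹) *
          monomialIntegral ψ fun i => if i ∈ T then s i + 2 else s i by
    simpa using h Finset.univ
  intro T
  induction T using Finset.induction_on with
  | empty => exact ⟨φ, hφ, hφc, by simp⟩
  | insert j T hj ih =>
    obtain ⟨ψ, hψ, hψc, hT⟩ := ih
    obtain ⟨χ, hχ, hχc, hstep⟩ := exists_monomialIntegral_eq_coord hψ hψc j
    refine ⟨χ, hχ, hχc, fun s hs => ?_⟩
    rw [hT s hs, hstep _ fun i => ?_, Finset.prod_insert hj]
    · have hupd : Function.update (fun i => if i ∈ T then s i + 2 else s i) j (s j + 2) =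
          fun i => if i ∈ insert j T then s i + 2 else s i := by
        ext i
        by_cases hi : i = j
        · subst hi; simp
        · simp [hi]
      simp only [if_neg hj, hupd]
      ring
    · have := hs i
      split_ifs
      · simp; linarith
      · exact this

/-- The candidate continuation of a monomial integral to `Re s_i > -1 - 2 * N`. -/
noncomputable def shiftedIntegral {n : ℕ} (φ : (Fin n → ℝ) → ℝ) (N : ℕ) (s : Fin n → ℂ) : ℂ :=
  (∏ i, ∏ r ∈ Finset.range (2 * N), (s i + ((r : ℂ) + 1))⁻¹) *
    monomialIntegral φ fun i => s i + 2 * (N : ℂ)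

theorem exists_shiftedIntegral_eq_succ {n : ℕ} {φ : (Fin n → ℝ) → ℝ}
    (hφ : ContDiff ℝ (⊤ : ℕ∞) φ) (hφc : HasCompactSupport φ) :
    ∃ Φ : ℕ → (Fin n → ℝ) → ℝ, Φ 0 = φ ∧
      (∀ N, ContDiff ℝ (⊤ : ℕ∞) (Φ N) ∧ HasCompactSupport (Φ N)) ∧
      ∀ N : ℕ, ∀ s : Fin n → ℂ, (∀ i, -1 - 2 * (N : ℝ) < (s i).re) →
        shiftedIntegral (Φ N) N s = shiftedIntegral (Φ (N + 1)) (N + 1) s := by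
  choose f hf hfc heq using fun ψ : {ψ : (Fin n → ℝ) → ℝ //
    ContDiff ℝ (⊤ : ℕ∞) ψ ∧ HasCompactSupport ψ} => exists_monomialIntegral_eq ψ.2.1 ψ.2.2
  let Φ : ℕ → {ψ : (Fin n → ℝ) → ℝ // ContDiff ℝ (⊤ : ℕ∞) ψ ∧ HasCompactSupport ψ} := fun N =>
    (fun ψ => ⟨f ψ, hf ψ, hfc ψ⟩)^[N] ⟨φ, hφ, hφc⟩
  refine ⟨fun N => (Φ N).1, rfl, fun N => (Φ N).2, fun N s hs => ?_⟩
  have hΦ : (Φ (N + 1)).1 = f (Φ N) := by simp only [Φ, Function.iterate_succ_apply']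
  simp only [shiftedIntegral]
  rw [hΦ, heq _ _ fun i => ?_, ← mul_assoc, ← Finset.prod_mul_distrib]
  · congr 1
    · refine Finset.prod_congr rfl fun i _ => ?_
      rw [show 2 * (N + 1) = 2 * N + 1 + 1 by ring, Finset.prod_range_succ,
        Finset.prod_range_succ, mul_assoc, ← mul_inv]
      push_cast
      ring_nf
    · congr 1
      ext i
      push_cast
      ring
  · have := hs i
    simp; linarith

theorem shiftedIntegral_eq_of_le {n : ℕ} {Φ : ℕ → (Fin n → ℝ) → ℝ}
    (hΦ : ∀ N : ℕ, ∀ s : Fin n → ℂ, (∀ i, -1 - 2 * (N : ℝ) < (s i).re) →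
      shiftedIntegral (Φ N) N s = shiftedIntegral (Φ (N + 1)) (N + 1) s)
    {M N : ℕ} (hMN : M ≤ N) {s : Fin n → ℂ} (hs : ∀ i, -1 - 2 * (M : ℝ) < (s i).re) :
    shiftedIntegral (Φ M) M s = shiftedIntegral (Φ N) N s := by
  induction N, hMN using Nat.le_induction with
  | base => rfl
  | succ N hN ih =>
    refine ih.trans (hΦ N s fun i => ?_)
    have : (M : ℝ) ≤ N := by exact_mod_cast hN
    linarith [hs i]

theorem differentiable_exponent {n : ℕ} (l m : Fin n → ℝ) (c : ℂ) :
    Differentiable ℂ fun (z : ℂ) (i : Fin n) => (l i : ℂ) * z + (m i : ℂ) + c :=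
  differentiable_pi.2 fun i => by fun_prop

theorem analyticAt_monomialIntegral_exponent {n : ℕ} {φ : (Fin n → ℝ) → ℝ} (hφ : Continuous φ)
    (hφc : HasCompactSupport φ) (l m : Fin n → ℝ) {N : ℕ} {z : ℂ}
    (hz : ∀ i, -1 - 2 * (N : ℝ) < ((l i : ℂ) * z + (m i : ℂ)).re) :
    AnalyticAt ℂ (fun z => monomialIntegral φ
      fun i => (l i : ℂ) * z + (m i : ℂ) + 2 * (N : ℂ)) z := by
  refine analyticAt_monomialIntegral hφ hφc (differentiable_exponent l m (2 * (N : ℂ))) fun i => ?_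
  have := hz i
  rw [Complex.add_re]
  simp at this ⊢
  linarith

/-- A product of the factors `(a z + b + r + 1)⁻¹` has at most a simple pole, which occurs at `-μ`
only if `b + r = a μ` for a positive integer `r`. -/
theorem exists_tendsto_mul_prod_inv {a : ℝ} (ha : a ≠ 0) (b μ : ℝ) (N : ℕ) (S : Prop)
    [Decidable S] (hS : S ↔ ∃ r : ℕ, 0 < r ∧ (b + (r : ℝ)) / a = μ) :
    ∃ c : ℂ, Tendsto (fun z : ℂ => (if S then z + (μ : ℂ) else 1) *
      ∏ r ∈ Finset.range N, ((a : ℂ) * z + (b : ℂ) + ((r : ℂ) + 1))⁻¹)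
      (𝓝[≠] (-(μ : ℂ))) (𝓝 c) := by
  have hfactor : ∀ r : ℕ, (b + ((r + 1 : ℕ) : ℝ)) / a ≠ μ →
      ContinuousAt (fun z : ℂ => ((a : ℂ) * z + (b : ℂ) + ((r : ℂ) + 1))⁻¹) (-(μ : ℂ)) := by
    intro r hr
    refine ContinuousAt.inv₀ (by fun_prop) fun h0 => hr ?_
    rw [div_eq_iff ha]
    have : ((b + ((r + 1 : ℕ) : ℝ) : ℝ) : ℂ) = ((μ * a : ℝ) : ℂ) := by
      push_cast
      linear_combination h0
    exact_mod_cast this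
  have hprod : ∀ T : Finset ℕ, (∀ r ∈ T, (b + ((r + 1 : ℕ) : ℝ)) / a ≠ μ) →
      ContinuousAt (fun z : ℂ => ∏ r ∈ T, ((a : ℂ) * z + (b : ℂ) + ((r : ℂ) + 1))⁻¹)
        (-(μ : ℂ)) := fun T hT =>
    tendsto_finsetProd T fun r hr => hfactor r (hT r hr)
  by_cases hex : ∃ r ∈ Finset.range N, (b + ((r + 1 : ℕ) : ℝ)) / a = μ
  · obtain ⟨r, hrN, hr⟩ := hex
    have hab : b + ((r + 1 : ℕ) : ℝ) = μ * a := (div_eq_iff ha).1 hr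
    have hcont := hprod ((Finset.range N).erase r) fun q hq hqμ => by
      have := hab.trans ((div_eq_iff ha).1 hqμ).symm
      have hqr : r + 1 = q + 1 := by exact_mod_cast add_left_cancel this
      exact (Finset.mem_erase.1 hq).1 (by omega)
    refine ⟨_, ((hcont.tendsto.mono_left nhdsWithin_le_nhds).const_mul (a : ℂ)⁻¹).congr' ?_⟩
    filter_upwards [self_mem_nhdsWithin] with z hz
    have hz' : z + (μ : ℂ) ≠ 0 := fun h => hz (eq_neg_of_add_eq_zero_left h)
    have hlin : (a : ℂ) * z + (b : ℂ) + ((r : ℂ) + 1) = a * (z + μ) := by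
      have : ((b + ((r + 1 : ℕ) : ℝ) : ℝ) : ℂ) = ((μ * a : ℝ) : ℂ) := by rw [hab]
      push_cast at this
      linear_combination this
    rw [if_pos (hS.2 ⟨r + 1, r.succ_pos, hr⟩), ← Finset.mul_prod_erase _ _ hrN, hlin, mul_inv]
    field_simp
  · push Not at hex
    refine ⟨_, (ContinuousAt.tendsto (ContinuousAt.mul ?_ (hprod _ hex))).mono_left
      nhdsWithin_le_nhds⟩
    split_ifs <;> fun_prop

/-- For `n ≥ 1`, `l_i > 0`, `m_i ≥ 0` and `φ` smooth compactly supported, `H(φ)`, holomorphic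
for `Re λ > -min_i (m_i+1)/l_i`, extends to a meromorphic function on `ℂ` whose poles lie in
`P`, and at each `-λ_j ∈ P` the order of the pole is at most `k_j = #S_j`. -/
theorem stmt_8 (n : ℕ) (hn : 0 < n) (l m : Fin n → ℝ)
    (hl : ∀ i, 0 < l i) (hm : ∀ i, 0 ≤ m i)
    (φ : (Fin n → ℝ) → ℝ) (hφ : ContDiff ℝ (⊤ : ℕ∞) φ) (hφc : HasCompactSupport φ) :
    ∃ F : ℂ → ℂ,
      (∀ lam : ℂ, -(⨅ i, (m i + 1) / l i) < lam.re → F lam = Hint n l m φ lam) ∧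
      (∀ lam : ℂ, (¬ ∃ t ∈ polesP n l m, lam = (t : ℂ)) → AnalyticAt ℂ F lam) ∧
      (∀ μ : ℝ, -μ ∈ polesP n l m →
        ∃ c : ℂ, Tendsto (fun lam : ℂ => (lam + (μ : ℂ)) ^ (kOrd n l m μ) * F lam)
          (𝓝[≠] (-(μ : ℂ))) (𝓝 c)) := by
  classical
  obtain ⟨Φ, hΦ0, hΦ, hstep⟩ := exists_shiftedIntegral_eq_succ hφ hφc
  let s : ℂ → Fin n → ℂ := fun z i => (l i : ℂ) * z + (m i : ℂ)
  have hre : ∀ z i, (s z i).re = l i * z.re + m i := fun z i => by simp [s]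
  have hcover : ∀ z, ∃ N : ℕ, ∀ i, -1 - 2 * (N : ℝ) < (s z i).re := fun z => by
    choose N hN using fun i => exists_nat_gt (-(s z i).re)
    refine ⟨∑ i, N i, fun i => ?_⟩
    have hle : (N i : ℝ) ≤ ((∑ i, N i : ℕ) : ℝ) := by
      exact_mod_cast Finset.single_le_sum (fun i _ => Nat.zero_le (N i)) (Finset.mem_univ i)
    have hnonneg : (0 : ℝ) ≤ ((∑ i, N i : ℕ) : ℝ) := Nat.cast_nonneg _
    linarith [hN i]
  choose ν hν using hcover
  let F : ℂ → ℂ := fun z => shiftedIntegral (Φ (ν z)) (ν z) (s z)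
  have hF : ∀ (N : ℕ) (z : ℂ), (∀ i, -1 - 2 * (N : ℝ) < (s z i).re) →
      F z = shiftedIntegral (Φ N) N (s z) := fun N z hz => by
    rcases le_total N (ν z) with h | h
    · exact (shiftedIntegral_eq_of_le hstep h hz).symm
    · exact shiftedIntegral_eq_of_le hstep h (hν z)
  have hFev : ∀ z, F =ᶠ[𝓝 z] fun w => shiftedIntegral (Φ (ν z)) (ν z) (s w) := fun z => by
    have hev : ∀ᶠ w in 𝓝 z, ∀ i, -1 - 2 * (ν z : ℝ) < (s w i).re :=
      eventually_all.2 fun i => Tendsto.eventually (f := fun w => (s w i).re)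
        (Continuous.tendsto (by simp only [hre]; fun_prop) z) (lt_mem_nhds (hν z i))
    filter_upwards [hev] with w hw using hF _ w hw
  have hana : ∀ z, AnalyticAt ℂ (fun w => monomialIntegral (Φ (ν z))
      fun i => s w i + 2 * (ν z : ℂ)) z := fun z =>
    analyticAt_monomialIntegral_exponent (hΦ _).1.continuous (hΦ _).2 l m (hν z)
  refine ⟨F, fun z hz => ?_, fun z hz => ?_, fun μ _ => ?_⟩
  · rw [hF 0 z fun i => ?_]
    · simp [shiftedIntegral, hΦ0, monomialIntegral, Hint, s]
    · have hi := ciInf_le (finite_range fun i => (m i + 1) / l i).bddBelow i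
      have : -z.re < (m i + 1) / l i := by linarith
      rw [lt_div_iff₀ (hl i)] at this
      rw [hre]
      push_cast
      linarith
  · refine AnalyticAt.congr ?_ (hFev z).symm
    refine AnalyticAt.mul (Finset.analyticAt_fun_prod _ fun i _ =>
      Finset.analyticAt_fun_prod _ fun r _ => ?_) (hana z)
    refine AnalyticAt.inv (by fun_prop) fun h0 => hz ?_
    refine ⟨_, ⟨i, r + 1, r.succ_pos, rfl⟩, ?_⟩
    have hli : (l i : ℂ) ≠ 0 := by exact_mod_cast (hl i).ne'
    push_cast
    field_simp
    linear_combination h0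
  · let S : Fin n → Prop := fun i => ∃ r : ℕ, 0 < r ∧ (m i + (r : ℝ)) / l i = μ
    have hpow : ∀ z : ℂ, (z + (μ : ℂ)) ^ kOrd n l m μ = ∏ i, if S i then z + (μ : ℂ) else 1 := by
      intro z
      rw [Finset.prod_ite, Finset.prod_const, Finset.prod_const_one, mul_one, kOrd,
        ← Set.ncard_coe_finset]
      simp [S]
    choose c hc using fun i => exists_tendsto_mul_prod_inv (hl i).ne' (m i) μ
      (2 * ν (-(μ : ℂ))) (S i) Iff.rfl
    refine ⟨_, ((tendsto_finsetProd Finset.univ fun i _ => hc i).mul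
      ((hana (-(μ : ℂ))).continuousAt.tendsto.mono_left nhdsWithin_le_nhds)).congr' ?_⟩
    filter_upwards [(hFev (-(μ : ℂ))).filter_mono nhdsWithin_le_nhds] with z hz
    rw [hz, hpow, shiftedIntegral, ← mul_assoc, ← Finset.prod_mul_distrib]
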